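/- arXiv:2604.17146 — 4 statements merged into one kernel-verified Lean document; each statement's English description precedes it below -/
import Mathlib

section
/- Let α, β, γ be integers and let n, k, ℓ be nonnegative integers with k ≥ 2 and ℓ ≥ 1. Then S^{≤ℓ}_{α,β,γ}(n+1, k) = γ · S^{≤ℓ}_{α,β,γ−α}(n, k) + γ · Σ_{i = max(1, n+1−ℓ)}^{n} C(n,i) (β−α)_{n−i,α} S^{≤ℓ}_{α,β,γ−α}(i−1, k−1) + Σ_{i = max(1, n+1−ℓ)}^{n} C(n,i) (β−α)_{n−i,α} Σ_{j = max(0, i−ℓ)}^{i−1} C(i−1, j) (β−α)_{i−1−j,α} S^{≤ℓ}_{α,β,γ}(j, k−2), where C(·,·) denotes binomial coefficients. -/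
open Finset
open scoped Classical

/-- Degenerate falling factorial `(t)_{m,λ} = t(t-λ)⋯(t-(m-1)λ)`. -/
def dff {R : Type*} [CommRing R] (t : R) (m : ℕ) (lam : R) : R :=
  ∏ i ∈ Finset.range m, (t - (i : R) * lam)

/-- `P` is a set partition of the finset `S` into `k` nonempty blocks. -/
def IsPartitionInto {n : ℕ} (S : Finset (Fin n)) (k : ℕ)
    (P : Finset (Finset (Fin n))) : Prop :=
  P.card = k ∧ (∀ B ∈ P, B.Nonempty) ∧
    (∀ B ∈ P, ∀ C ∈ P, B ≠ C → Disjoint B C) ∧ P.sup id = S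

/-- Generalized Stirling number `S_{α,β,γ}(n,k)`: weighted sum over pairs `(G,P)`
where `G ⊆ [n]` and `P` partitions `[n] \ G` into `k` nonempty blocks, with weight
`(γ)_{|G|,α} · ∏_{B∈P} (β-α)_{|B|-1,α}`. -/
noncomputable def genStirling {R : Type*} [CommRing R] (a b g : R) (n k : ℕ) : R :=
  ∑ G : Finset (Fin n),
    ∑ P ∈ Finset.univ.filter (fun P => IsPartitionInto Gᶜ k P),
      dff g G.card a * ∏ B ∈ P, dff (b - a) (B.card - 1) a

/-- Restricted generalized Stirling number `S^{≤ℓ}_{α,β,γ}(n,k)`: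
as `genStirling` but every block of `P` has at most `ℓ` elements. -/
noncomputable def genStirlingLe {R : Type*} [CommRing R] (a b g : R) (n k l : ℕ) : R :=
  ∑ G : Finset (Fin n),
    ∑ P ∈ Finset.univ.filter
        (fun P => IsPartitionInto Gᶜ k P ∧ ∀ B ∈ P, B.card ≤ l),
      dff g G.card a * ∏ B ∈ P, dff (b - a) (B.card - 1) a

/-- `S^{>ℓ}_γ(n,k)`: weighted sum over pairs `(G,P)` where `P` partitions
`[n] \ G` into `k` nonempty blocks each of size `> ℓ`, with weight `γ^{|G|}`. -/
noncomputable def Sgt {R : Type*} [CommRing R] (g : R) (n k l : ℕ) : R :=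
  ∑ G : Finset (Fin n),
    ∑ _P ∈ Finset.univ.filter
        (fun P : Finset (Finset (Fin n)) =>
          IsPartitionInto Gᶜ k P ∧ ∀ B ∈ P, l < B.card),
      g ^ G.card

/-- Associated Stirling number of the second kind `S_{≥ℓ}(n,k)`: the number of
set partitions of `[n]` into `k` nonempty blocks each of size at least `ℓ`. -/
noncomputable def assocStirling (n k l : ℕ) : ℕ :=
  (Finset.univ.filter
    (fun P : Finset (Finset (Fin n)) =>
      IsPartitionInto Finset.univ k P ∧ ∀ B ∈ P, l ≤ B.card)).card

/-- Partial degenerate partition number `S^{γ,α,β}_{n,k,ℓ}`: weighted sum over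
pairs `(G,P)` with weight `γ^{|G|} · ∏_{B∈P, |B|≤ℓ} (β-α)_{|B|-1,α}`. -/
noncomputable def partialS {R : Type*} [CommRing R] (g a b : R) (n k l : ℕ) : R :=
  ∑ G : Finset (Fin n),
    ∑ P ∈ Finset.univ.filter (fun P => IsPartitionInto Gᶜ k P),
      g ^ G.card * ∏ B ∈ P, (if B.card ≤ l then dff (b - a) (B.card - 1) a else 1)

/-- `S^{≤ℓ}_{α,β}(n,k)`: sum over set partitions of `[n]` into `k` nonempty blocks
each with at most `ℓ` elements, of the weight `∏_{B∈P} (β-α)_{|B|-1,α}`. -/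
noncomputable def SleRestr {R : Type*} [CommRing R] (a b : R) (n k l : ℕ) : R :=
  ∑ P ∈ Finset.univ.filter
      (fun P : Finset (Finset (Fin n)) =>
        IsPartitionInto Finset.univ k P ∧ ∀ B ∈ P, B.card ≤ l),
    ∏ B ∈ P, dff (b - a) (B.card - 1) a

/-- Sum over the set partitions of a set of `n` elements into `k` blocks of the product of
`c (|B| - 1)` over the blocks `B`, defined by recursion on the block of a fixed element. -/
def partitionWeight {R : Type*} [CommRing R] (c : ℕ → R) : ℕ → ℕ → R
  | 0, 0 => 1
  | 0, _ + 1 => 0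
  | _ + 1, 0 => 0
  | k + 1, n + 1 =>
    ∑ i ∈ Finset.range (n + 1), (n.choose i : R) * (c (n - i) * partitionWeight c k i)

lemma IsPartitionInto.subset {n k : ℕ} {S : Finset (Fin n)} {P : Finset (Finset (Fin n))}
    (h : IsPartitionInto S k P) {B : Finset (Fin n)} (hB : B ∈ P) : B ⊆ S := by
  rw [← h.2.2.2]
  exact Finset.le_sup (f := id) hB

lemma isPartitionInto_zero {n : ℕ} {S : Finset (Fin n)} {P : Finset (Finset (Fin n))} :
    IsPartitionInto S 0 P ↔ P = ∅ ∧ S = ∅ := by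
  constructor
  · rintro ⟨h, -, -, hs⟩
    rw [Finset.card_eq_zero] at h
    subst h
    exact ⟨rfl, by simpa using hs.symm⟩
  · rintro ⟨rfl, rfl⟩
    simp [IsPartitionInto]

lemma not_isPartitionInto_empty {n k : ℕ} (P : Finset (Finset (Fin n))) :
    ¬ IsPartitionInto ∅ (k + 1) P := by
  intro h
  obtain ⟨B, hB⟩ := Finset.card_pos.1 (k.succ_pos.trans_eq h.1.symm)
  exact (h.2.1 B hB).ne_empty (Finset.subset_empty.1 (h.subset hB))

lemma IsPartitionInto.insert_sdiff {n k : ℕ} {S V : Finset (Fin n)} {x : Fin n} (hx : x ∈ S)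
    (hV : V ⊆ S.erase x) {Q : Finset (Finset (Fin n))} (h : IsPartitionInto V k Q) :
    S \ V ∉ Q ∧ IsPartitionInto S (k + 1) (insert (S \ V) Q) := by
  have hxV : x ∉ V := fun hxV => Finset.notMem_erase x S (hV hxV)
  have hxB : x ∈ S \ V := Finset.mem_sdiff.2 ⟨hx, hxV⟩
  have hn : S \ V ∉ Q := fun hQ => hxV (h.subset hQ hxB)
  have hd : ∀ B ∈ Q, Disjoint (S \ V) B := fun B hB =>
    Finset.sdiff_disjoint.mono_right (h.subset hB)
  refine ⟨hn, ?_, ?_, ?_, ?_⟩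
  · rw [Finset.card_insert_of_notMem hn, h.1]
  · intro B hB
    rcases Finset.mem_insert.1 hB with rfl | hB
    · exact ⟨x, hxB⟩
    · exact h.2.1 B hB
  · intro B hB C hC hBC
    rcases Finset.mem_insert.1 hB with rfl | hB <;> rcases Finset.mem_insert.1 hC with rfl | hC
    · exact absurd rfl hBC
    · exact hd C hC
    · exact (hd B hB).symm
    · exact h.2.2.1 B hB C hC hBC
  · rw [Finset.sup_insert, h.2.2.2]
    exact Finset.sdiff_union_of_subset (hV.trans (Finset.erase_subset x S))

lemma IsPartitionInto.erase {n k : ℕ} {S B : Finset (Fin n)} {P : Finset (Finset (Fin n))}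
    (h : IsPartitionInto S (k + 1) P) (hB : B ∈ P) :
    IsPartitionInto (S \ B) k (P.erase B) := by
  refine ⟨?_, fun C hC => h.2.1 C (Finset.mem_of_mem_erase hC),
    fun C hC D hD => h.2.2.1 C (Finset.mem_of_mem_erase hC) D (Finset.mem_of_mem_erase hD), ?_⟩
  · rw [Finset.card_erase_of_mem hB, h.1, Nat.add_sub_cancel]
  · have hd : Disjoint ((P.erase B).sup id) B := by
      rw [Finset.disjoint_sup_left]
      intro C hC
      exact h.2.2.1 C (Finset.mem_of_mem_erase hC) B hB (Finset.ne_of_mem_erase hC)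
    have hs : S = B ∪ (P.erase B).sup id := by
      conv_lhs => rw [← h.2.2.2, ← Finset.insert_erase hB, Finset.sup_insert]
      rfl
    rw [hs, Finset.union_sdiff_left, Finset.sdiff_eq_self_of_disjoint hd]

lemma sum_isPartitionInto_succ {R : Type*} [CommRing R] (c : ℕ → R) {n k : ℕ}
    {S : Finset (Fin n)} {x : Fin n} (hx : x ∈ S) :
    ∑ P ∈ Finset.univ.filter (fun P => IsPartitionInto S (k + 1) P), ∏ B ∈ P, c (B.card - 1) =
      ∑ V ∈ (S.erase x).powerset, c ((S.erase x).card - V.card) *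
        ∑ Q ∈ Finset.univ.filter (fun Q => IsPartitionInto V k Q), ∏ B ∈ Q, c (B.card - 1) := by
  simp_rw [Finset.mul_sum]
  rw [Finset.sum_sigma']
  symm
  refine Finset.sum_bij (fun p _ => insert (S \ p.1) p.2) ?_ ?_ ?_ ?_
  · rintro ⟨V, Q⟩ h
    simp only [Finset.mem_sigma, Finset.mem_powerset, Finset.mem_filter, Finset.mem_univ,
      true_and] at h ⊢
    exact (h.2.insert_sdiff hx h.1).2
  · rintro ⟨V, Q⟩ h ⟨V', Q'⟩ h' heq
    simp only [Finset.mem_sigma, Finset.mem_powerset, Finset.mem_filter, Finset.mem_univ,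
      true_and] at h h' heq
    have hxV : x ∉ V := fun hxV => Finset.notMem_erase x S (h.1 hxV)
    have hxV' : x ∉ V' := fun hxV => Finset.notMem_erase x S (h'.1 hxV)
    have hB : S \ V = S \ V' := by
      have hm : S \ V ∈ insert (S \ V') Q' := heq ▸ Finset.mem_insert_self _ _
      rcases Finset.mem_insert.1 hm with hm | hm
      · exact hm
      · exact absurd (h'.2.subset hm (Finset.mem_sdiff.2 ⟨hx, hxV⟩)) hxV'
    have hQ : Q = Q' := by
      rw [← Finset.erase_insert (h.2.insert_sdiff hx h.1).1, heq, hB,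
        Finset.erase_insert (h'.2.insert_sdiff hx h'.1).1]
    have hV : V = V' := by rw [← h.2.2.2.2, ← h'.2.2.2.2, hQ]
    rw [hV, hQ]
  · intro P hP
    replace hP := (Finset.mem_filter.1 hP).2
    obtain ⟨B, hB, hxB⟩ : ∃ B ∈ P, x ∈ B := by
      have hxS := hx
      rw [← hP.2.2.2, Finset.mem_sup] at hxS
      exact hxS
    refine ⟨⟨S \ B, P.erase B⟩, ?_, ?_⟩
    · simp only [Finset.mem_sigma, Finset.mem_powerset, Finset.mem_filter, Finset.mem_univ,
        true_and]
      refine ⟨fun y hy => ?_, hP.erase hB⟩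
      rw [Finset.mem_sdiff] at hy
      exact Finset.mem_erase.2 ⟨fun h => hy.2 (h ▸ hxB), hy.1⟩
    · simp only
      rw [Finset.sdiff_sdiff_eq_self (hP.subset hB), Finset.insert_erase hB]
  · rintro ⟨V, Q⟩ h
    simp only [Finset.mem_sigma, Finset.mem_powerset, Finset.mem_filter, Finset.mem_univ,
      true_and] at h ⊢
    rw [Finset.prod_insert (h.2.insert_sdiff hx h.1).1,
      Finset.card_sdiff_of_subset (h.1.trans (Finset.erase_subset x S)),
      Finset.card_erase_of_mem hx, Nat.sub_right_comm]

lemma sum_isPartitionInto_eq_partitionWeight {R : Type*} [CommRing R] (c : ℕ → R) {n : ℕ} (k : ℕ)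
    (S : Finset (Fin n)) :
    ∑ P ∈ Finset.univ.filter (fun P => IsPartitionInto S k P), ∏ B ∈ P, c (B.card - 1) =
      partitionWeight c k S.card := by
  induction k generalizing S with
  | zero =>
    rcases S.eq_empty_or_nonempty with rfl | hS
    · have : Finset.univ.filter (fun P => IsPartitionInto (∅ : Finset (Fin n)) 0 P) = {∅} := by
        ext P
        simp [isPartitionInto_zero]
      rw [this]
      simp [partitionWeight]
    · obtain ⟨m, hm⟩ := Nat.exists_eq_succ_of_ne_zero hS.card_ne_zero
      rw [hm]
      simp [isPartitionInto_zero, hS.ne_empty, partitionWeight]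
  | succ k ih =>
    rcases S.eq_empty_or_nonempty with rfl | ⟨x, hx⟩
    · simp [not_isPartitionInto_empty, partitionWeight]
    · rw [sum_isPartitionInto_succ c hx]
      simp_rw [ih]
      rw [Finset.sum_powerset_apply_card
        (fun m => c ((S.erase x).card - m) * partitionWeight c k m),
        ← Finset.card_erase_add_one hx]
      simp only [partitionWeight, nsmul_eq_mul]

/-- The weight of a block with `d + 1` elements in `genStirlingLe a b g n k l`. -/
noncomputable def blockWeight {R : Type*} [CommRing R] (a b : R) (l d : ℕ) : R :=
  if d + 1 ≤ l then dff (b - a) d a else 0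

lemma genStirlingLe_eq_sum {R : Type*} [CommRing R] (a b g : R) (n k l : ℕ) :
    genStirlingLe a b g n k l =
      ∑ m ∈ Finset.range (n + 1),
        (n.choose m : R) * (dff g m a * partitionWeight (blockWeight a b l) k (n - m)) := by
  have h : ∀ G : Finset (Fin n),
      ∑ P ∈ Finset.univ.filter (fun P => IsPartitionInto Gᶜ k P ∧ ∀ B ∈ P, B.card ≤ l),
        dff g G.card a * ∏ B ∈ P, dff (b - a) (B.card - 1) a =
      dff g G.card a * partitionWeight (blockWeight a b l) k (n - G.card) := by
    intro G
    have hG : n - G.card = Gᶜ.card := by rw [Finset.card_compl, Fintype.card_fin]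
    rw [← Finset.mul_sum, ← Finset.filter_filter, Finset.sum_filter, hG, ← sum_isPartitionInto_eq_partitionWeight]
    congr 1
    refine Finset.sum_congr rfl fun P hP => ?_
    trans ∏ B ∈ P, if B.card ≤ l then dff (b - a) (B.card - 1) a else 0
    · rw [Finset.prod_ite_zero]
      congr
    refine Finset.prod_congr rfl fun B hB => ?_
    have := ((Finset.mem_filter.1 hP).2.2.1 B hB).card_pos
    rw [blockWeight, Nat.sub_add_cancel this]
  rw [genStirlingLe]
  simp_rw [h]
  rw [← Finset.powerset_univ, Finset.sum_powerset_apply_card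
    (fun m => dff g m a * partitionWeight (blockWeight a b l) k (n - m))]
  simp

lemma dff_succ {R : Type*} [CommRing R] (t : R) (m : ℕ) (lam : R) :
    dff t (m + 1) lam = t * dff (t - lam) m lam := by
  rw [dff, dff, Finset.prod_range_succ', mul_comm]
  congr 1
  · simp
  · refine Finset.prod_congr rfl fun i _ => ?_
    push_cast
    ring

lemma genStirlingLe_zero_succ {R : Type*} [CommRing R] (a b g : R) (k l : ℕ) :
    genStirlingLe a b g 0 (k + 1) l = 0 := by
  simp [genStirlingLe_eq_sum, partitionWeight]

/-- Recurrence obtained by deciding whether one element lies in `G` or in a block of `P`. -/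
lemma genStirlingLe_succ_succ {R : Type*} [CommRing R] (a b g : R) (n k l : ℕ) :
    genStirlingLe a b g (n + 1) (k + 1) l =
      g * genStirlingLe a b (g - a) n (k + 1) l +
        ∑ i ∈ Finset.Icc (n + 1 - l) n,
          (n.choose i : R) * dff (b - a) (n - i) a * genStirlingLe a b g i k l := by
  have hIcc : ∑ i ∈ Finset.Icc (n + 1 - l) n,
        (n.choose i : R) * dff (b - a) (n - i) a * genStirlingLe a b g i k l =
      ∑ i ∈ Finset.range (n + 1),
        (n.choose i : R) * blockWeight a b l (n - i) * genStirlingLe a b g i k l := by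
    have hf : Finset.Icc (n + 1 - l) n =
        (Finset.range (n + 1)).filter (fun i => n - i + 1 ≤ l) := by
      ext i
      simp only [Finset.mem_Icc, Finset.mem_filter, Finset.mem_range]
      omega
    rw [hf, Finset.sum_filter]
    refine Finset.sum_congr rfl fun i _ => ?_
    rw [blockWeight]
    split_ifs <;> simp
  have hblock : ∑ m ∈ Finset.range (n + 1), (n.choose m : R) *
        (dff g m a * partitionWeight (blockWeight a b l) (k + 1) (n + 1 - m)) =
      ∑ i ∈ Finset.range (n + 1),
        (n.choose i : R) * blockWeight a b l (n - i) * genStirlingLe a b g i k l := by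
    simp_rw [genStirlingLe_eq_sum, Finset.mul_sum]
    rw [Finset.sum_comm' (t' := Finset.range (n + 1)) (s' := fun m => Finset.Ico m (n + 1))]
    · refine Finset.sum_congr rfl fun m hm => ?_
      have hmn : m ≤ n := Nat.lt_succ_iff.1 (Finset.mem_range.1 hm)
      rw [Nat.sub_add_comm hmn, partitionWeight, Finset.sum_Ico_eq_sum_range,
        Nat.sub_add_comm hmn, Finset.mul_sum, Finset.mul_sum]
      refine Finset.sum_congr rfl fun j hj => ?_
      have hjn : m + j ≤ n := by
        have := Finset.mem_range.1 hj
        omega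
      have hc : (n.choose (m + j) : R) * ((m + j).choose m : R) =
          (n.choose m : R) * ((n - m).choose j : R) := by
        have := Nat.choose_mul (n := n) (k := m + j) (s := m) (Nat.le_add_right m j)
        rw [Nat.add_sub_cancel_left] at this
        exact_mod_cast congrArg (Nat.cast : ℕ → R) this
      rw [Nat.add_sub_cancel_left, Nat.sub_sub]
      linear_combination (-(blockWeight a b l (n - (m + j)) * dff g m a *
        partitionWeight (blockWeight a b l) k j)) * hc
    · intro i m
      simp only [Finset.mem_range, Finset.mem_Ico]
      omega
  rw [hIcc, ← hblock, genStirlingLe_eq_sum, genStirlingLe_eq_sum, Finset.sum_range_succ']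
  simp_rw [Nat.choose_succ_succ, Nat.cast_add, add_mul]
  rw [Finset.sum_add_distrib, add_assoc]
  congr 1
  · rw [Finset.mul_sum]
    refine Finset.sum_congr rfl fun m _ => ?_
    rw [dff_succ, Nat.add_sub_add_right]
    ring
  · rw [Finset.sum_range_succ, Finset.sum_range_succ' _ n]
    simp

theorem stmt3 (a b g : ℤ) (n k l : ℕ) (hk : 2 ≤ k) (hl : 1 ≤ l) :
    genStirlingLe a b g (n + 1) k l =
      g * genStirlingLe a b (g - a) n k l +
        g * ∑ i ∈ Finset.Icc (max 1 (n + 1 - l)) n,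
              (n.choose i : ℤ) * dff (b - a) (n - i) a *
                genStirlingLe a b (g - a) (i - 1) (k - 1) l +
        ∑ i ∈ Finset.Icc (max 1 (n + 1 - l)) n,
          (n.choose i : ℤ) * dff (b - a) (n - i) a *
            ∑ j ∈ Finset.Icc (i - l) (i - 1),
              ((i - 1).choose j : ℤ) * dff (b - a) (i - 1 - j) a *
                genStirlingLe a b g j (k - 2) l := by
  obtain ⟨k, rfl⟩ := Nat.exists_eq_add_of_le' hk
  have hIcc : ∑ i ∈ Finset.Icc (n + 1 - l) n,
        (n.choose i : ℤ) * dff (b - a) (n - i) a * genStirlingLe a b g i (k + 1) l =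
      ∑ i ∈ Finset.Icc (max 1 (n + 1 - l)) n,
        (n.choose i : ℤ) * dff (b - a) (n - i) a * genStirlingLe a b g i (k + 1) l := by
    symm
    refine Finset.sum_subset (Finset.Icc_subset_Icc_left (le_max_right _ _)) fun i hi hi' => ?_
    have hi0 : i = 0 := by
      simp only [Finset.mem_Icc] at hi hi'
      omega
    rw [hi0, genStirlingLe_zero_succ, mul_zero]
  rw [genStirlingLe_succ_succ, hIcc, add_assoc (g * _)]
  congr 1
  rw [Finset.mul_sum, ← Finset.sum_add_distrib]
  refine Finset.sum_congr rfl fun i hi => ?_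
  obtain ⟨i, rfl⟩ : ∃ j, i = j + 1 :=
    Nat.exists_eq_add_of_le' ((le_max_left _ _).trans (Finset.mem_Icc.1 hi).1)
  rw [genStirlingLe_succ_succ, mul_add]
  simp only [Nat.add_sub_cancel, show k + 2 - 1 = k + 1 from rfl]
  ring
end

section
/- Let γ be an integer and let n, k, ℓ be nonnegative integers. Then S^{>ℓ}_γ(n+1, k) = γ · S^{>ℓ}_γ(n, k) + Σ_{i=0}^{n} γ^i C(n,i) S_{≥ℓ+1}(n+1−i, k), where C(n,i) is the binomial coefficient. -/
open Finset
open scoped Classical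

theorem isPartitionInto_map {m n : ℕ} (f : Fin m ↪ Fin n) (S : Finset (Fin m)) (k : ℕ)
    (Q : Finset (Finset (Fin m))) :
    IsPartitionInto (S.map f) k (Q.map (Finset.mapEmbedding f).toEmbedding) ↔
      IsPartitionInto S k Q := by
  have hsup : (Q.map (Finset.mapEmbedding f).toEmbedding).sup id = (Q.sup id).map f := by
    ext x
    simp only [Finset.mem_sup, Finset.mem_map]
    constructor
    · rintro ⟨_, ⟨B, hB, rfl⟩, hx⟩
      obtain ⟨y, hy, rfl⟩ := Finset.mem_map.1 hx
      exact ⟨y, ⟨B, hB, hy⟩, rfl⟩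
    · rintro ⟨y, ⟨B, hB, hy⟩, rfl⟩
      exact ⟨B.map f, ⟨B, hB, rfl⟩, Finset.mem_map_of_mem f hy⟩
  unfold IsPartitionInto
  rw [hsup, Finset.map_inj]
  simp [Finset.disjoint_map]

/-- The number of partitions of a finset into large blocks depends only on its cardinality. -/
theorem card_partitions_eq_assocStirling {n : ℕ} (S : Finset (Fin n)) (k l : ℕ) :
    (Finset.univ.filter (fun P : Finset (Finset (Fin n)) =>
      IsPartitionInto S k P ∧ ∀ B ∈ P, l ≤ B.card)).card = assocStirling S.card k l := by
  let f := (S.orderEmbOfFin rfl).toEmbedding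
  have hf : Finset.univ.map f = S := S.map_orderEmbOfFin_univ rfl
  symm
  refine Finset.card_bij (fun Q _ => Q.map (Finset.mapEmbedding f).toEmbedding) ?_ ?_ ?_
  · intro Q hQ
    simp only [Finset.mem_filter, Finset.mem_univ, true_and] at hQ ⊢
    refine ⟨by simpa only [hf] using (isPartitionInto_map f Finset.univ k Q).2 hQ.1, ?_⟩
    simpa using hQ.2
  · intro Q _ Q' _ h
    exact Finset.map_injective _ h
  · intro P hP
    simp only [Finset.mem_filter, Finset.mem_univ, true_and] at hP
    have hsub : P ⊆ Finset.univ.map (Finset.mapEmbedding f).toEmbedding := by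
      intro B hB
      have hBS : B ⊆ Finset.univ.map f := by
        rw [hf, ← hP.1.2.2.2]
        exact Finset.le_sup (f := id) hB
      obtain ⟨C, -, rfl⟩ := Finset.subset_map_iff.1 hBS
      exact Finset.mem_map_of_mem _ (Finset.mem_univ C)
    obtain ⟨Q, -, rfl⟩ := Finset.subset_map_iff.1 hsub
    refine ⟨Q, ?_, rfl⟩
    simp only [Finset.mem_filter, Finset.mem_univ, true_and]
    refine ⟨(isPartitionInto_map f Finset.univ k Q).1 (by simpa only [hf] using hP.1), ?_⟩
    simpa using hP.2

theorem Sgt_eq_sum_choose {R : Type*} [CommRing R] (g : R) (n k l : ℕ) :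
    Sgt g n k l = ∑ i ∈ Finset.range (n + 1),
      (n.choose i : R) * (g ^ i * (assocStirling (n - i) k (l + 1) : R)) := by
  have hinner (G : Finset (Fin n)) :
      (∑ _P ∈ Finset.univ.filter (fun P : Finset (Finset (Fin n)) =>
          IsPartitionInto Gᶜ k P ∧ ∀ B ∈ P, l < B.card), g ^ G.card) =
        g ^ G.card * (assocStirling (n - G.card) k (l + 1) : R) := by
    have h := card_partitions_eq_assocStirling Gᶜ k (l + 1)
    rw [Finset.card_compl, Fintype.card_fin] at h
    rw [Finset.sum_const, nsmul_eq_mul, mul_comm, ← h]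
    simp only [Nat.succ_le_iff]
  unfold Sgt
  simp_rw [hinner]
  rw [← Finset.powerset_univ,
    Finset.sum_powerset_apply_card
      (fun i => g ^ i * (assocStirling (n - i) k (l + 1) : R))]
  simp [nsmul_eq_mul]

theorem stmt6 (g : ℤ) (n k l : ℕ) :
    Sgt g (n + 1) k l =
      g * Sgt g n k l +
        ∑ i ∈ Finset.range (n + 1),
          g ^ i * (n.choose i : ℤ) * (assocStirling (n + 1 - i) k (l + 1) : ℤ) := by
  rw [Sgt_eq_sum_choose, Sgt_eq_sum_choose, Finset.sum_range_succ', Finset.mul_sum]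
  simp_rw [Nat.choose_succ_succ, Nat.add_sub_add_right]
  push_cast
  simp_rw [add_mul]
  rw [Finset.sum_add_distrib, add_assoc]
  congr 1
  · exact Finset.sum_congr rfl fun i _ => by ring
  · rw [Finset.sum_range_succ, Finset.sum_range_succ' (n := n)]
    simp only [Nat.choose_succ_self, Nat.cast_zero, zero_mul, add_zero, Nat.choose_zero_right,
      Nat.add_sub_add_right]
    congr 1
    · exact Finset.sum_congr rfl fun i _ => by ring
    · simp
end

section
/- Let α, β, γ be integers and let n, k, ℓ be nonnegative integers. Then S^{γ,α,β}_{n+1,k,ℓ} = Σ_{i=0}^{n} Σ_{j=0}^{k} C(n,i) · [ S^{>ℓ}_γ(i+1, j) · S^{≤ℓ}_{α,β}(n−i, k−j) + S^{>ℓ}_γ(i, j) · S^{≤ℓ}_{α,β}(n−i+1, k−j) ], where C(n,i) is the binomial coefficient. -/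
open Finset
open scoped Classical

namespace IsPartitionInto

variable {n j k : ℕ} {S T : Finset (Fin n)} {P Q : Finset (Finset (Fin n))}

lemma subset_s8 (h : IsPartitionInto S k P) {B : Finset (Fin n)} (hB : B ∈ P) : B ⊆ S :=
  h.2.2.2 ▸ Finset.le_sup (f := id) hB

lemma disjoint_of_disjoint (hP : IsPartitionInto S j P) (hQ : IsPartitionInto T k Q)
    (hST : Disjoint S T) : Disjoint P Q := by
  rw [Finset.disjoint_left]
  intro B hBP hBQ
  obtain ⟨x, hx⟩ := hP.2.1 B hBP
  exact Finset.disjoint_left.mp hST (hP.subset_s8 hBP hx) (hQ.subset_s8 hBQ hx)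

lemma union (hP : IsPartitionInto S j P) (hQ : IsPartitionInto T k Q)
    (hST : Disjoint S T) : IsPartitionInto (S ∪ T) (j + k) (P ∪ Q) := by
  refine ⟨?_, ?_, ?_, ?_⟩
  · rw [Finset.card_union_of_disjoint (hP.disjoint_of_disjoint hQ hST), hP.1, hQ.1]
  · intro B hB
    exact (Finset.mem_union.mp hB).elim (hP.2.1 B) (hQ.2.1 B)
  · intro B hB C hC hBC
    rcases Finset.mem_union.mp hB with hB | hB <;> rcases Finset.mem_union.mp hC with hC | hC
    · exact hP.2.2.1 B hB C hC hBC
    · exact hST.mono (hP.subset_s8 hB) (hQ.subset_s8 hC)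
    · exact hST.symm.mono (hQ.subset_s8 hB) (hP.subset_s8 hC)
    · exact hQ.2.2.1 B hB C hC hBC
  · rw [Finset.sup_union, hP.2.2.2, hQ.2.2.2, Finset.sup_eq_union]

lemma filter (h : IsPartitionInto S k P) (q : Finset (Fin n) → Prop) [DecidablePred q] :
    IsPartitionInto ((P.filter q).sup id) (P.filter q).card (P.filter q) :=
  ⟨rfl, fun B hB => h.2.1 B (Finset.mem_filter.mp hB).1,
    fun B hB C hC => h.2.2.1 B (Finset.mem_filter.mp hB).1 C (Finset.mem_filter.mp hC).1, rfl⟩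

lemma filter_not (h : IsPartitionInto S k P) (q : Finset (Fin n) → Prop) [DecidablePred q] :
    IsPartitionInto (S \ (P.filter q).sup id) (k - (P.filter q).card)
      (P.filter fun B => ¬ q B) := by
  have h' := h.filter fun B => ¬ q B
  have hcard : (P.filter fun B => ¬ q B).card = k - (P.filter q).card := by
    have := Finset.card_filter_add_card_filter_not (s := P) q
    have := h.1
    omega
  have hsup : (P.filter fun B => ¬ q B).sup id = S \ (P.filter q).sup id := by
    ext x
    simp only [← h.2.2.2, Finset.mem_sdiff, Finset.mem_sup, Finset.mem_filter, id]
    constructor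
    · rintro ⟨B, ⟨hB, hqB⟩, hx⟩
      refine ⟨⟨B, hB, hx⟩, ?_⟩
      rintro ⟨C, ⟨hC, hqC⟩, hxC⟩
      have hBC : B ≠ C := fun e => hqB (e ▸ hqC)
      exact Finset.disjoint_left.mp (h.2.2.1 B hB C hC hBC) hx hxC
    · rintro ⟨⟨B, hB, hx⟩, hno⟩
      exact ⟨B, ⟨hB, fun hq => hno ⟨B, ⟨hB, hq⟩, hx⟩⟩, hx⟩
  rwa [hcard, hsup] at h'

end IsPartitionInto

/-- The family of images of the blocks of `P` under an embedding, as an embedding. -/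
def mapBlocks {m n : ℕ} (f : Fin m ↪ Fin n) :
    Finset (Finset (Fin m)) ↪ Finset (Finset (Fin n)) :=
  (Finset.mapEmbedding (Finset.mapEmbedding f).toEmbedding).toEmbedding

lemma mem_mapBlocks {m n : ℕ} {f : Fin m ↪ Fin n} {P : Finset (Finset (Fin m))}
    {B : Finset (Fin n)} : B ∈ mapBlocks f P ↔ ∃ C ∈ P, C.map f = B := by
  simp [mapBlocks]

lemma isPartitionInto_mapBlocks {m n k : ℕ} (f : Fin m ↪ Fin n) {S : Finset (Fin m)}
    {P : Finset (Finset (Fin m))} :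
    IsPartitionInto (S.map f) k (mapBlocks f P) ↔ IsPartitionInto S k P := by
  have hsup : (mapBlocks f P).sup id = (P.sup id).map f := by
    ext x
    simp only [Finset.mem_sup, mem_mapBlocks, Finset.mem_map, id]
    constructor
    · rintro ⟨_, ⟨C, hC, rfl⟩, hx⟩
      obtain ⟨y, hy, rfl⟩ := Finset.mem_map.mp hx
      exact ⟨y, ⟨C, hC, hy⟩, rfl⟩
    · rintro ⟨y, ⟨C, hC, hy⟩, rfl⟩
      exact ⟨_, ⟨C, hC, rfl⟩, Finset.mem_map_of_mem f hy⟩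
  have hcard : (mapBlocks f P).card = P.card := Finset.card_map _
  simp only [IsPartitionInto, hsup, hcard, mem_mapBlocks, forall_exists_index, and_imp,
    forall_apply_eq_imp_iff₂, Finset.map_nonempty, Finset.disjoint_map, Finset.map_inj, ne_eq]

/-- The partitions of the image of `S` are the images of the partitions of `S`. -/
lemma filter_isPartitionInto_map {m n k : ℕ} (f : Fin m ↪ Fin n) (S : Finset (Fin m))
    (q : ℕ → Prop) :
    (univ.filter fun P => IsPartitionInto (S.map f) k P ∧ ∀ B ∈ P, q B.card) =
      (univ.filter fun P => IsPartitionInto S k P ∧ ∀ B ∈ P, q B.card).map (mapBlocks f) := by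
  ext P
  simp only [Finset.mem_filter, Finset.mem_univ, true_and, Finset.mem_map]
  constructor
  · rintro ⟨hP, hq⟩
    have hex : ∃ Q, mapBlocks f Q = P := by
      refine ⟨univ.filter fun C => C.map f ∈ P, ?_⟩
      ext B
      simp only [mem_mapBlocks, Finset.mem_filter, Finset.mem_univ, true_and]
      constructor
      · rintro ⟨C, hC, rfl⟩
        exact hC
      · intro hB
        obtain ⟨C, -, rfl⟩ := Finset.subset_map_iff.mp (hP.subset_s8 hB)
        exact ⟨C, hB, rfl⟩
    obtain ⟨Q, rfl⟩ := hex
    refine ⟨Q, ⟨(isPartitionInto_mapBlocks f).mp hP, fun B hB => ?_⟩, rfl⟩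
    simpa using hq _ (mem_mapBlocks.mpr ⟨B, hB, rfl⟩)
  · rintro ⟨Q, ⟨hQ, hq⟩, rfl⟩
    refine ⟨(isPartitionInto_mapBlocks f).mpr hQ, fun B hB => ?_⟩
    obtain ⟨C, hC, rfl⟩ := mem_mapBlocks.mp hB
    simpa using hq C hC

/-- The sum over partitions of `S` into `k` blocks with cardinalities satisfying `q`
of the product of `w |B|` over all blocks `B`. -/
noncomputable def blockSum {R : Type*} [CommRing R] {n : ℕ} (q : ℕ → Prop) (w : ℕ → R)
    (S : Finset (Fin n)) (k : ℕ) : R :=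
  ∑ P ∈ univ.filter (fun P => IsPartitionInto S k P ∧ ∀ B ∈ P, q B.card), ∏ B ∈ P, w B.card

section

variable {R : Type*} [CommRing R]

lemma blockSum_map {m n : ℕ} (f : Fin m ↪ Fin n) (q : ℕ → Prop) (w : ℕ → R)
    (S : Finset (Fin m)) (k : ℕ) : blockSum q w (S.map f) k = blockSum q w S k := by
  simp [blockSum, filter_isPartitionInto_map, mapBlocks]

lemma blockSum_eq_sum_powerset {n : ℕ} (q : ℕ → Prop) (w : ℕ → R) (T : Finset (Fin n))
    (k : ℕ) :
    blockSum (fun _ => True) w T k = ∑ U ∈ T.powerset, ∑ j ∈ range (k + 1),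
      blockSum q w U j * blockSum (fun c => ¬ q c) w (T \ U) (k - j) := by
  rw [← Finset.sum_product']
  unfold blockSum
  rw [← Finset.sum_fiberwise_of_maps_to (t := T.powerset ×ˢ range (k + 1))
    (g := fun P => ((P.filter fun B => q B.card).sup id, (P.filter fun B => q B.card).card))]
  · refine Finset.sum_congr rfl ?_
    rintro ⟨U, j⟩ hUj
    simp only [Finset.mem_product, Finset.mem_powerset, Finset.mem_range] at hUj
    obtain ⟨hU, hj⟩ := hUj
    rw [Finset.sum_mul_sum, ← Finset.sum_product']
    have hdisj : Disjoint U (T \ U) := Finset.disjoint_sdiff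
    refine Finset.sum_nbij'
      (fun P => (P.filter fun B => q B.card, P.filter fun B => ¬ q B.card))
      (fun X => X.1 ∪ X.2) ?_ ?_ ?_ ?_ ?_
    · intro P hP
      simp only [Finset.mem_filter, Finset.mem_univ, true_and, Prod.mk.injEq] at hP
      obtain ⟨⟨hP, -⟩, rfl, rfl⟩ := hP
      simp only [Finset.mem_product, Finset.mem_filter, Finset.mem_univ, true_and]
      exact ⟨⟨hP.filter _, fun B hB => hB.2⟩, hP.filter_not _, fun B hB => hB.2⟩
    · rintro ⟨P₁, P₂⟩ hX
      simp only [Finset.mem_product, Finset.mem_filter, Finset.mem_univ, true_and] at hX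
      obtain ⟨⟨h₁, q₁⟩, h₂, q₂⟩ := hX
      have hu := h₁.union h₂ hdisj
      rw [Finset.union_sdiff_of_subset hU, show j + (k - j) = k by omega] at hu
      have hf : ((P₁ ∪ P₂).filter fun B => q B.card) = P₁ := by
        rw [Finset.filter_union, Finset.filter_true_of_mem q₁, Finset.filter_false_of_mem q₂,
          Finset.union_empty]
      simp only [Finset.mem_filter, Finset.mem_univ, true_and, hf]
      exact ⟨⟨hu, fun _ _ => trivial⟩, by rw [h₁.1, h₁.2.2.2]⟩
    · intro P _
      exact Finset.filter_union_filter_not_eq _ P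
    · rintro ⟨P₁, P₂⟩ hX
      simp only [Finset.mem_product, Finset.mem_filter, Finset.mem_univ, true_and] at hX
      obtain ⟨⟨-, q₁⟩, -, q₂⟩ := hX
      simp only [Prod.mk.injEq]
      constructor
      · rw [Finset.filter_union, Finset.filter_true_of_mem q₁, Finset.filter_false_of_mem q₂,
          Finset.union_empty]
      · rw [Finset.filter_union, Finset.filter_true_of_mem q₂,
          Finset.filter_false_of_mem fun B hB => not_not.mpr (q₁ B hB), Finset.empty_union]
    · intro P _
      exact (Finset.prod_filter_mul_prod_filter_not P _ _).symm
  · intro P hP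
    simp only [Finset.mem_filter, Finset.mem_univ, true_and] at hP
    simp only [Finset.mem_product, Finset.mem_powerset, Finset.mem_range]
    refine ⟨Finset.sup_le fun B hB => hP.1.subset_s8 (Finset.mem_filter.mp hB).1, ?_⟩
    have := Finset.card_filter_le P fun B => q B.card
    have := hP.1.1
    omega

lemma SleRestr_eq_blockSum (a b : R) {n : ℕ} (S : Finset (Fin n)) (k l : ℕ) :
    SleRestr a b S.card k l = blockSum (fun c => ¬ l < c)
      (fun c => if c ≤ l then dff (b - a) (c - 1) a else 1) S k := by
  have hS : S = univ.map (S.orderEmbOfFin rfl).toEmbedding := by simp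
  conv_rhs => rw [hS, blockSum_map]
  simp only [SleRestr, blockSum, not_lt]
  refine Finset.sum_congr rfl fun P hP => Finset.prod_congr rfl fun B hB => ?_
  rw [if_pos ((Finset.mem_filter.mp hP).2.2 B hB)]

lemma Sgt_eq_sum_blockSum_map (a b g : R) {m n : ℕ} (f : Fin m ↪ Fin n) (k l : ℕ) :
    Sgt g m k l = ∑ G ∈ (univ.map f).powerset, g ^ G.card * blockSum (fun c => l < c)
      (fun c => if c ≤ l then dff (b - a) (c - 1) a else 1) (univ.map f \ G) k := by
  have hpow : (univ.map f).powerset = univ.map (Finset.mapEmbedding f).toEmbedding := by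
    ext G
    simp [Finset.subset_map_iff, eq_comm]
  rw [hpow, Finset.sum_map]
  refine Finset.sum_congr rfl fun G _ => ?_
  have hG : univ.map f \ G.map f = Gᶜ.map f := by
    rw [Finset.compl_eq_univ_sdiff, Finset.map_sdiff]
  simp only [RelEmbedding.coe_toEmbedding, Finset.mapEmbedding_apply, Finset.card_map, hG,
    blockSum_map]
  rw [blockSum, Finset.mul_sum]
  refine Finset.sum_congr (by ext; simp only [Finset.mem_filter]) fun P hP => ?_
  simp only [Finset.mem_filter] at hP
  rw [Finset.prod_eq_one, mul_one]
  intro B hB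
  rw [if_neg (not_le.mpr (hP.2.2 B hB))]

lemma Sgt_eq_sum_blockSum (a b g : R) {n : ℕ} (S : Finset (Fin n)) (k l : ℕ) :
    Sgt g S.card k l = ∑ G ∈ S.powerset, g ^ G.card * blockSum (fun c => l < c)
      (fun c => if c ≤ l then dff (b - a) (c - 1) a else 1) (S \ G) k := by
  have h := Sgt_eq_sum_blockSum_map a b g (S.orderEmbOfFin rfl).toEmbedding k l
  rwa [Finset.map_orderEmbOfFin_univ] at h

lemma partialS_eq_sum_finset (g a b : R) (n k l : ℕ) :
    partialS g a b n k l = ∑ S : Finset (Fin n), ∑ j ∈ range (k + 1),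
      Sgt g S.card j l * SleRestr a b (n - S.card) (k - j) l := by
  set w : ℕ → R := fun c => if c ≤ l then dff (b - a) (c - 1) a else 1 with hw
  have hpartial : partialS g a b n k l =
      ∑ G : Finset (Fin n), ∑ U ∈ Gᶜ.powerset, g ^ G.card * ∑ j ∈ range (k + 1),
        blockSum (fun c => l < c) w U j * blockSum (fun c => ¬ l < c) w (Gᶜ \ U) (k - j) := by
    refine Finset.sum_congr rfl fun G _ => ?_
    rw [← Finset.mul_sum, ← Finset.mul_sum, ← blockSum_eq_sum_powerset (fun c => l < c)]
    simp [blockSum, hw]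
  have hsummand : ∀ S : Finset (Fin n), ∑ j ∈ range (k + 1),
      Sgt g S.card j l * SleRestr a b (n - S.card) (k - j) l =
      ∑ G ∈ S.powerset, g ^ G.card * ∑ j ∈ range (k + 1),
        blockSum (fun c => l < c) w (S \ G) j * blockSum (fun c => ¬ l < c) w Sᶜ (k - j) := by
    intro S
    have hc : n - S.card = Sᶜ.card := by rw [Finset.card_compl, Fintype.card_fin]
    simp_rw [hc, SleRestr_eq_blockSum, Sgt_eq_sum_blockSum a b, Finset.mul_sum, Finset.sum_mul]
    rw [Finset.sum_comm]
    simp only [mul_assoc, hw]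
  rw [hpartial, Finset.sum_congr rfl fun S _ => hsummand S, Finset.sum_sigma', Finset.sum_sigma']
  refine Finset.sum_nbij' (fun X => ⟨X.1 ∪ X.2, X.1⟩) (fun Y => ⟨Y.2, Y.1 \ Y.2⟩)
    ?_ ?_ ?_ ?_ ?_
  · rintro ⟨G, U⟩ _
    simp only [Finset.mem_sigma, Finset.mem_univ, Finset.mem_powerset, true_and]
    exact Finset.subset_union_left
  · rintro ⟨S, G⟩ h
    simp only [Finset.mem_sigma, Finset.mem_univ, Finset.mem_powerset, true_and]
    intro x hx
    simp_all
  · rintro ⟨G, U⟩ h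
    simp only [Finset.mem_sigma, Finset.mem_univ, Finset.mem_powerset, true_and] at h
    have : (G ∪ U) \ G = U := by
      rw [Finset.union_sdiff_cancel_left (Finset.disjoint_left.mpr fun x hG hU => by
        simpa [hG] using h hU)]
    simp [this]
  · rintro ⟨S, G⟩ h
    simp only [Finset.mem_sigma, Finset.mem_univ, Finset.mem_powerset, true_and] at h
    simp [Finset.union_eq_right.mpr h]
  · rintro ⟨G, U⟩ h
    simp only [Finset.mem_sigma, Finset.mem_univ, Finset.mem_powerset, true_and] at h
    have h₁ : (G ∪ U) \ G = U := by
      rw [Finset.union_sdiff_cancel_left (Finset.disjoint_left.mpr fun x hG hU => by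
        simpa [hG] using h hU)]
    have h₂ : Gᶜ \ U = (G ∪ U)ᶜ := by
      ext x
      simp
    simp only [h₁, h₂]

/-- Binomial convolution: choose the set of elements lying in `G` or in a block with more
than `l` elements. -/
lemma partialS_eq_sum_choose (g a b : R) (n k l : ℕ) :
    partialS g a b n k l = ∑ m ∈ range (n + 1), (n.choose m : R) * ∑ j ∈ range (k + 1),
      Sgt g m j l * SleRestr a b (n - m) (k - j) l := by
  rw [partialS_eq_sum_finset, ← Finset.powerset_univ, Finset.sum_powerset_apply_card
    (fun m => ∑ j ∈ range (k + 1), Sgt g m j l * SleRestr a b (n - m) (k - j) l)]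
  simp

end

lemma sum_range_choose_succ_mul {R : Type*} [CommRing R] (n : ℕ) (f : ℕ → R) :
    ∑ m ∈ range (n + 2), ((n + 1).choose m : R) * f m =
      ∑ i ∈ range (n + 1), (n.choose i : R) * (f (i + 1) + f i) := by
  rw [Finset.sum_range_succ']
  simp only [Nat.choose_succ_succ, Nat.cast_add, add_mul, mul_add, Finset.sum_add_distrib,
    Nat.choose_zero_right]
  rw [Finset.sum_range_succ (fun i => (n.choose (i + 1) : R) * f (i + 1)),
    Finset.sum_range_succ' (fun i => (n.choose i : R) * f i)]
  simp
  ring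

theorem stmt8 (a b g : ℤ) (n k l : ℕ) :
    partialS g a b (n + 1) k l =
      ∑ i ∈ Finset.range (n + 1), ∑ j ∈ Finset.range (k + 1),
        (n.choose i : ℤ) *
          (Sgt g (i + 1) j l * SleRestr a b (n - i) (k - j) l +
            Sgt g i j l * SleRestr a b (n - i + 1) (k - j) l) := by
  rw [partialS_eq_sum_choose, sum_range_choose_succ_mul]
  refine Finset.sum_congr rfl fun i hi => ?_
  have hi' : n + 1 - i = n - i + 1 := by
    have := Finset.mem_range.mp hi
    omega
  rw [← Finset.sum_add_distrib, Finset.mul_sum, Nat.add_sub_add_right, hi']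
end

section
/- Let α, β be integers and let n, k be nonnegative integers with k ≥ 1. Then S_{α,β}(n+1, k) = S_{α,β,β−α}(n, k−1). -/
open Finset
open scoped Classical

theorem isPartitionInto_iff {n : ℕ} (S : Finset (Fin n)) (k : ℕ)
    (P : Finset (Finset (Fin n))) :
    IsPartitionInto S k P ↔ P.card = k ∧ (∀ B ∈ P, B.Nonempty) ∧
      (∀ B ∈ P, ∀ C ∈ P, ∀ x, x ∈ B → x ∈ C → B = C) ∧ ∀ x, (∃ B ∈ P, x ∈ B) ↔ x ∈ S := by
  unfold IsPartitionInto
  refine and_congr_right fun _ => and_congr_right fun _ => and_congr ?_ ?_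
  · refine forall₄_congr fun B _ C _ => ?_
    rw [Finset.disjoint_left]
    constructor
    · intro h x hB hC
      by_contra hne
      exact h hne hB hC
    · intro h hne x hB hC
      exact hne (h x hB hC)
  · simp [Finset.ext_iff, Finset.mem_sup]

/-- The subset `C` of `Fin n` shifted by one inside `Fin (n + 1)`. -/
def shiftBlock {n : ℕ} : Finset (Fin n) ↪ Finset (Fin (n + 1)) :=
  (Finset.mapEmbedding (Fin.succEmb n)).toEmbedding

theorem zero_notMem_shiftBlock {n : ℕ} (C : Finset (Fin n)) : 0 ∉ shiftBlock C := by
  simp [shiftBlock, Fin.succ_ne_zero]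

theorem succ_mem_shiftBlock {n : ℕ} (C : Finset (Fin n)) (x : Fin n) :
    x.succ ∈ shiftBlock C ↔ x ∈ C := by
  simp [shiftBlock]

theorem card_shiftBlock {n : ℕ} (C : Finset (Fin n)) : (shiftBlock C).card = C.card := by
  simp [shiftBlock]

/-- Shift all blocks of `P` and add the block `{0} ∪ (G + 1)`. -/
noncomputable def addZeroBlock {n : ℕ} (G : Finset (Fin n)) (P : Finset (Finset (Fin n))) :
    Finset (Finset (Fin (n + 1))) :=
  insert (insert 0 (shiftBlock G)) (P.map shiftBlock)

/-- The elements other than `0` in the block of `0`, shifted down. -/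
noncomputable def zeroBlockRest {n : ℕ} (P : Finset (Finset (Fin (n + 1)))) : Finset (Fin n) :=
  Finset.univ.filter fun i => ∃ B ∈ P, 0 ∈ B ∧ i.succ ∈ B

/-- The blocks of `P` that do not contain `0`, shifted down. -/
noncomputable def otherBlocks {n : ℕ} (P : Finset (Finset (Fin (n + 1)))) :
    Finset (Finset (Fin n)) :=
  Finset.univ.filter fun C => shiftBlock C ∈ P

theorem zeroBlock_notMem_map {n : ℕ} (G : Finset (Fin n)) (P : Finset (Finset (Fin n))) :
    insert 0 (shiftBlock G) ∉ P.map shiftBlock := by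
  intro h
  obtain ⟨C, -, hC⟩ := Finset.mem_map.1 h
  exact zero_notMem_shiftBlock C (hC ▸ Finset.mem_insert_self _ _)

theorem zeroBlockRest_addZeroBlock {n : ℕ} (G : Finset (Fin n)) (P : Finset (Finset (Fin n))) :
    zeroBlockRest (addZeroBlock G P) = G := by
  ext i
  simp [zeroBlockRest, addZeroBlock, zero_notMem_shiftBlock, succ_mem_shiftBlock,
    Fin.succ_ne_zero]

theorem otherBlocks_addZeroBlock {n : ℕ} (G : Finset (Fin n)) (P : Finset (Finset (Fin n))) :
    otherBlocks (addZeroBlock G P) = P := by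
  ext C
  have h : shiftBlock C ≠ insert 0 (shiftBlock G) := fun h =>
    zero_notMem_shiftBlock C (h ▸ Finset.mem_insert_self _ _)
  simp [otherBlocks, addZeroBlock, h]

theorem exists_shiftBlock_eq {n : ℕ} {B : Finset (Fin (n + 1))} (h : 0 ∉ B) :
    ∃ C, shiftBlock C = B := by
  refine ⟨Finset.univ.filter fun i => i.succ ∈ B, ?_⟩
  ext x
  cases x using Fin.cases with
  | zero => simp [h, zero_notMem_shiftBlock]
  | succ x => simp [succ_mem_shiftBlock]

theorem addZeroBlock_rest_other {n k : ℕ} {P : Finset (Finset (Fin (n + 1)))}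
    (hP : IsPartitionInto Finset.univ k P) :
    addZeroBlock (zeroBlockRest P) (otherBlocks P) = P := by
  rw [isPartitionInto_iff] at hP
  obtain ⟨-, -, hd, hu⟩ := hP
  obtain ⟨B₀, hB₀, h0⟩ := (hu 0).2 (Finset.mem_univ _)
  have hrest : insert 0 (shiftBlock (zeroBlockRest P)) = B₀ := by
    ext x
    cases x using Fin.cases with
    | zero => simp [h0]
    | succ x =>
      simp only [Finset.mem_insert, Fin.succ_ne_zero, false_or, succ_mem_shiftBlock,
        zeroBlockRest, Finset.mem_filter, Finset.mem_univ, true_and]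
      constructor
      · rintro ⟨B, hB, hB0, hx⟩
        rwa [← hd B hB B₀ hB₀ 0 hB0 h0]
      · exact fun hx => ⟨B₀, hB₀, h0, hx⟩
  ext B
  rw [addZeroBlock, hrest, Finset.mem_insert, Finset.mem_map]
  constructor
  · rintro (rfl | ⟨C, hC, rfl⟩)
    · exact hB₀
    · simpa [otherBlocks] using hC
  · intro hB
    by_cases hB0 : 0 ∈ B
    · exact Or.inl (hd B hB B₀ hB₀ 0 hB0 h0)
    · obtain ⟨C, rfl⟩ := exists_shiftBlock_eq hB0
      exact Or.inr ⟨C, by simpa [otherBlocks] using hB, rfl⟩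

theorem isPartitionInto_addZeroBlock {n k : ℕ} {G : Finset (Fin n)}
    {P : Finset (Finset (Fin n))} :
    IsPartitionInto Finset.univ (k + 1) (addZeroBlock G P) ↔ IsPartitionInto Gᶜ k P := by
  rw [isPartitionInto_iff, isPartitionInto_iff, addZeroBlock,
    Finset.card_insert_of_notMem (zeroBlock_notMem_map G P), Finset.card_map,
    Nat.add_right_cancel_iff]
  have hne (C : Finset (Fin n)) : (shiftBlock C).Nonempty ↔ C.Nonempty := by
    rw [← Finset.card_pos, card_shiftBlock, Finset.card_pos]
  have hne0 (C : Finset (Fin n)) : insert 0 (shiftBlock G) ≠ shiftBlock C := fun h =>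
    zero_notMem_shiftBlock C (h ▸ Finset.mem_insert_self _ _)
  refine and_congr_right fun _ => ?_
  simp [Fin.forall_fin_succ, hne, hne0, (hne0 _).symm, succ_mem_shiftBlock,
    zero_notMem_shiftBlock, Fin.succ_ne_zero]
  grind

theorem dff_zero_left {R : Type*} [CommRing R] {m : ℕ} (hm : m ≠ 0) (lam : R) :
    dff 0 m lam = 0 :=
  Finset.prod_eq_zero (Finset.mem_range.2 (Nat.pos_of_ne_zero hm)) (by simp)

theorem genStirling_zero {R : Type*} [CommRing R] (a b : R) (n k : ℕ) :
    genStirling a b 0 n k =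
      ∑ P ∈ Finset.univ.filter (fun P : Finset (Finset (Fin n)) =>
        IsPartitionInto Finset.univ k P), ∏ B ∈ P, dff (b - a) (B.card - 1) a := by
  rw [genStirling, Finset.sum_eq_single ∅]
  · simp [dff]
  · intro G _ hG
    simp [dff_zero_left (Finset.card_ne_zero.2 (Finset.nonempty_iff_ne_empty.2 hG))]
  · simp

theorem prod_dff_addZeroBlock {R : Type*} [CommRing R] (t a : R) {n : ℕ} (G : Finset (Fin n))
    (P : Finset (Finset (Fin n))) :
    ∏ B ∈ addZeroBlock G P, dff t (B.card - 1) a =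
      dff t G.card a * ∏ B ∈ P, dff t (B.card - 1) a := by
  rw [addZeroBlock, Finset.prod_insert (zeroBlock_notMem_map G P), Finset.prod_map,
    Finset.card_insert_of_notMem (zero_notMem_shiftBlock G)]
  simp [card_shiftBlock]

theorem genStirling_zero_succ {R : Type*} [CommRing R] (a b : R) (n k : ℕ) :
    genStirling a b 0 (n + 1) (k + 1) = genStirling a b (b - a) n k := by
  rw [genStirling_zero, genStirling, Finset.sum_sigma']
  refine Finset.sum_bij' (fun P _ => ⟨zeroBlockRest P, otherBlocks P⟩)
    (fun x _ => addZeroBlock x.1 x.2) ?_ ?_ ?_ ?_ ?_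
  · intro P hP
    have hP := (Finset.mem_filter.1 hP).2
    simp only [Finset.mem_sigma, Finset.mem_univ, Finset.mem_filter, true_and]
    rwa [← isPartitionInto_addZeroBlock, addZeroBlock_rest_other hP]
  · intro x hx
    simp only [Finset.mem_sigma, Finset.mem_univ, Finset.mem_filter, true_and] at hx ⊢
    exact isPartitionInto_addZeroBlock.2 hx
  · intro P hP
    exact addZeroBlock_rest_other (Finset.mem_filter.1 hP).2
  · intro x _
    simp [zeroBlockRest_addZeroBlock, otherBlocks_addZeroBlock]
  · intro P hP
    rw [← prod_dff_addZeroBlock, addZeroBlock_rest_other (Finset.mem_filter.1 hP).2]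

theorem stmt14 (a b : ℤ) (n k : ℕ) (hk : 1 ≤ k) :
    genStirling a b 0 (n + 1) k = genStirling a b (b - a) n (k - 1) := by
  obtain ⟨k, rfl⟩ := Nat.exists_eq_add_of_le' hk
  exact genStirling_zero_succ a b n k
end
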